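/- Let f : [0,1] → ℝ be continuous with f(0) = f(1) = 0 and f(r) > 0 for all r ∈ (0,1), and suppose that f takes distinct values at distinct local minimum points in (0,1) (i.e., if s ≠ t in (0,1) are both local minimum points of f, then f(s) ≠ f(t)). Define L(f) = ⋃_{s ∼_f t} [e^{2πis}, e^{2πit}] ⊆ ℂ, and assume that L(f) is closed and is a lamination of the closed unit disk that is maximal for inclusion among laminations (the only lamination containing L(f) is L(f) itself). For each n ≥ 1, let Q_n be a noncrossing partition of {0, 1, …, n−1}, let ℓ^n be its encoding 2n-step Dyck path under the bijection Φ, and let L_n : [0,1] → ℝ be the piecewise-linear function with L_n(k/(2n)) = ℓ^n_k for 0 ≤ k ≤ 2n. Suppose there exist positive reals a_n such that a_n·L_n converges to f uniformly on [0,1]. Then the Hausdorff distance between the lamination Λ_n(Q_n) and L(f) tends to 0 as n → ∞. -/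

import Mathlib

/-- `ℓ : ℕ → ℕ` is a (normalized) `2n`-step Dyck path: `ℓ 0 = 0`, `ℓ j = 0` for every
`j ≥ 2n` (in particular `ℓ (2n) = 0`), and consecutive values differ by exactly `1`
up to time `2n`. -/
def IsDyckPath (n : ℕ) (ℓ : ℕ → ℕ) : Prop :=
  ℓ 0 = 0 ∧ (∀ j, 2 * n ≤ j → ℓ j = 0) ∧
    ∀ k, k < 2 * n → ℓ (k + 1) = ℓ k + 1 ∨ ℓ k = ℓ (k + 1) + 1

/-- The relation `i ∼_ℓ j` for a `2n`-step Dyck path: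
`i, j ≤ 2n` and `ℓ i = ℓ j = min_{min(i,j) ≤ k ≤ max(i,j)} ℓ k`. -/
def DyckRel (n : ℕ) (ℓ : ℕ → ℕ) (i j : ℕ) : Prop :=
  i ≤ 2 * n ∧ j ≤ 2 * n ∧ ℓ i = ℓ j ∧
    ∀ k, min i j ≤ k → k ≤ max i j → ℓ i ≤ ℓ k

/-- `P` is a set partition of `{0, 1, …, n-1}`, blocks being the elements of `P`. -/
def IsPartitionOf (n : ℕ) (P : Set (Set ℕ)) : Prop :=
  (∀ B ∈ P, B.Nonempty) ∧ (∀ B ∈ P, B ⊆ Set.Iio n) ∧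
    ∀ i, i < n → ∃! B, B ∈ P ∧ i ∈ B

/-- A collection of blocks is noncrossing: there are no `a < b < c < d`
with `a, c` in one block and `b, d` in a different block. -/
def IsNoncrossing (P : Set (Set ℕ)) : Prop :=
  ∀ a b c d : ℕ, a < b → b < c → c < d →
    ∀ B ∈ P, ∀ B' ∈ P, a ∈ B → c ∈ B → b ∈ B' → d ∈ B' → B = B'

/-- `P` is a noncrossing partition of `{0, 1, …, n-1}`. -/
def IsNCPartition (n : ℕ) (P : Set (Set ℕ)) : Prop :=
  IsPartitionOf n P ∧ IsNoncrossing P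

/-- `P` is a noncrossing pair partition of `{0, 1, …, n-1}`:
a noncrossing partition all of whose blocks have exactly two elements. -/
def IsNCPairPartition (n : ℕ) (P : Set (Set ℕ)) : Prop :=
  IsNCPartition n P ∧ ∀ B ∈ P, B.ncard = 2

/-- `Φ(ℓ)`: the set partition of `{0, 1, …, n-1}` whose blocks are the equivalence
classes of `∼_ℓ` among the even indices `0, 2, …, 2n-2`, identifying `2j` with `j`. -/
def dyckEvenClasses (n : ℕ) (ℓ : ℕ → ℕ) : Set (Set ℕ) :=
  {B | ∃ j, j < n ∧ B = {i | i < n ∧ DyckRel n ℓ (2 * i) (2 * j)}}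

/-- `Ψ(ℓ)`: the set partition of `{0, 1, …, n-1}` whose blocks are the equivalence
classes of `∼_ℓ` among the odd indices `1, 3, …, 2n-1`, identifying `2j+1` with `j`. -/
def dyckOddClasses (n : ℕ) (ℓ : ℕ → ℕ) : Set (Set ℕ) :=
  {B | ∃ j, j < n ∧ B = {i | i < n ∧ DyckRel n ℓ (2 * i + 1) (2 * j + 1)}}

/-- The set partition of `{0, 1, …, 2n-1}` whose blocks are the equivalence classes of
`∼_ℓ` among the even indices `0, 2, …, 2n-2` together with the equivalence classes of
`∼_ℓ` among the odd indices `1, 3, …, 2n-1`. -/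
def dyckParityClasses (n : ℕ) (ℓ : ℕ → ℕ) : Set (Set ℕ) :=
  {B | ∃ j, j < 2 * n ∧ B = {i | i < 2 * n ∧ i % 2 = j % 2 ∧ DyckRel n ℓ i j}}

/-- The vertex `ω_n^k = exp(2πik/n)` of the regular `n`-gon. -/
noncomputable def vtx (n k : ℕ) : ℂ :=
  Complex.exp (2 * Real.pi * Complex.I * k / n)

/-- The point `exp(2πis)` of the unit circle. -/
noncomputable def circlePt (s : ℝ) : ℂ :=
  Complex.exp (2 * Real.pi * Complex.I * s)

/-- The closed polygonal set associated with a block `B ⊆ {0, …, n-1}`: the union of the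
segments joining cyclically consecutive vertices `ω_n^i`, `i ∈ B` (edges join `i < j` in `B`
with no element of `B` strictly between them, together with the closing edge joining the
minimum and the maximum of `B`; a singleton contributes a single point). -/
noncomputable def blockPolygon (n : ℕ) (B : Set ℕ) : Set ℂ :=
  ⋃ i ∈ B, ⋃ j ∈ B,
    ⋃ (_ : i ≤ j ∧ ((∀ k ∈ B, ¬(i < k ∧ k < j)) ∨ (∀ k ∈ B, i ≤ k ∧ k ≤ j))),
      segment ℝ (vtx n i) (vtx n j)

/-- The lamination `Λ_n(P) ⊆ ℂ` of a set partition `P` of `{0, …, n-1}`. -/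
noncomputable def lamination (n : ℕ) (P : Set (Set ℕ)) : Set ℂ :=
  ⋃ B ∈ P, blockPolygon n B

/-- The insert move at position `k` on a `2n`-step Dyck path: insert one up-step
followed by one down-step right after time `k`. -/
def insertMove (ℓ : ℕ → ℕ) (k : ℕ) : ℕ → ℕ :=
  fun j => if j ≤ k then ℓ j else if j = k + 1 then ℓ k + 1 else ℓ (j - 2)

/-- `m(ℓ,k)`: the first time after `k` (and at most `2n`) at which the path goes strictly
below its height at time `k`, or `2n+1` if there is no such time. -/
noncomputable def liftTime (n : ℕ) (ℓ : ℕ → ℕ) (k : ℕ) : ℕ :=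
  sInf ({j | k < j ∧ j ≤ 2 * n ∧ ℓ j < ℓ k} ∪ {2 * n + 1})

/-- The lift move at position `k` on a `2n`-step Dyck path: lift up by one the part of the
path between time `k` and time `m(ℓ,k)`. -/
noncomputable def liftMove (n : ℕ) (ℓ : ℕ → ℕ) (k : ℕ) : ℕ → ℕ :=
  fun j => if j ≤ k then ℓ j
    else if j ≤ liftTime n ℓ k then ℓ (j - 1) + 1
    else ℓ (j - 2)

/-- Apply the move `ε ∈ {insert, lift}` (`true` = insert, `false` = lift) at position `k`. -/
noncomputable def applyMove (n : ℕ) (ℓ : ℕ → ℕ) (k : ℕ) (ε : Bool) : ℕ → ℕ :=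
  if ε then insertMove ℓ k else liftMove n ℓ k

/-- The halving map sending a `4n`-step Dyck path `ℓ` (with `|ℓ_{2k+2} - ℓ_{2k}| = 2`)
to the path `(ℓ_0/2, ℓ_2/2, …, ℓ_{4n}/2)`. -/
def halveMap (ℓ : ℕ → ℕ) : ℕ → ℕ := fun j => ℓ (2 * j) / 2

/-- `φ(j) = ⌈j/2⌉ mod n`. -/
def pairPhi (n j : ℕ) : ℕ := ((j + 1) / 2) % n

/-- The edge relation on `{0, …, n-1}`: `x` and `y` are joined whenever `x = φ(a)` and
`y = φ(b)` for some block `{a, b}` of `Q`. -/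
def pairRel (n : ℕ) (Q : Set (Set ℕ)) (x y : ℕ) : Prop :=
  ∃ B ∈ Q, ∃ a ∈ B, ∃ b ∈ B, pairPhi n a = x ∧ pairPhi n b = y

/-- `π(Q)`: the set partition of `{0, …, n-1}` whose blocks are the connected components of
the graph on `{0, …, n-1}` with an edge `{φ(a), φ(b)}` for each block `{a, b}` of `Q`. -/
def pairProj (n : ℕ) (Q : Set (Set ℕ)) : Set (Set ℕ) :=
  {C | ∃ x, x < n ∧ C = {y | Relation.ReflTransGen (pairRel n Q) x y}}

/-- `A` is a lamination of the closed unit disk: a closed subset of the disk which is a union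
of chords (segments with endpoints on the unit circle, possibly degenerate) whose
intersections with the open unit disk are pairwise disjoint. -/
def IsLamination (A : Set ℂ) : Prop :=
  IsClosed A ∧ A ⊆ Metric.closedBall (0 : ℂ) 1 ∧
    ∃ C : Set (ℂ × ℂ),
      (∀ p ∈ C, ‖p.1‖ = 1 ∧ ‖p.2‖ = 1) ∧
      A = ⋃ p ∈ C, segment ℝ p.1 p.2 ∧
      ∀ p ∈ C, ∀ q ∈ C, segment ℝ p.1 p.2 ≠ segment ℝ q.1 q.2 →
        Disjoint (segment ℝ p.1 p.2 ∩ Metric.ball (0 : ℂ) 1)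
          (segment ℝ q.1 q.2 ∩ Metric.ball (0 : ℂ) 1)

/-- `s ∼_f t`: `f s = f t = min_{min(s,t) ≤ r ≤ max(s,t)} f r`. -/
def simRel (f : ℝ → ℝ) (s t : ℝ) : Prop :=
  f s = f t ∧ ∀ r, min s t ≤ r → r ≤ max s t → f s ≤ f r

/-- `L(f)`: the union of the chords `[exp(2πis), exp(2πit)]` over all `s ∼_f t`
in `[0,1]`. -/
noncomputable def brownLam (f : ℝ → ℝ) : Set ℂ :=
  ⋃ s ∈ Set.Icc (0 : ℝ) 1, ⋃ t ∈ Set.Icc (0 : ℝ) 1, ⋃ (_ : simRel f s t),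
    segment ℝ (circlePt s) (circlePt t)

section
open Filter Topology

lemma aux_vtx (n k : ℕ) : vtx n k = circlePt ((k : ℝ) / n) := by
  unfold vtx circlePt
  congr 1
  push_cast
  ring

lemma aux_cont : Continuous circlePt := by
  unfold circlePt
  fun_prop

lemma aux_evt (f : ℝ → ℝ) (ℓ : ℕ → ℕ → ℕ) (L : ℕ → ℝ → ℝ)
    (hL : ∀ n : ℕ, 1 ≤ n → ∀ k : ℕ, k < 2 * n → ∀ x : ℝ,
      x ∈ Set.Icc ((k : ℝ) / (2 * n)) (((k : ℝ) + 1) / (2 * n)) →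
      L n x = (ℓ n k : ℝ) + ((2 * n : ℝ) * x - (k : ℝ)) * ((ℓ n (k + 1) : ℝ) - (ℓ n k : ℝ)))
    (a : ℕ → ℝ)
    (hconv : TendstoUniformlyOn (fun n x => a n * L n x) f Filter.atTop (Set.Icc 0 1)) :
    ∀ η > 0, ∀ᶠ n : ℕ in atTop, ∀ k : ℕ, k ≤ 2 * n →
      |a n * ℓ n k - f ((k : ℝ) / (2 * n))| < η := by
  intro η hη
  have h := Metric.tendstoUniformlyOn_iff.1 hconv η hη
  filter_upwards [h, eventually_ge_atTop 1] with n hn h1 k hk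
  have hn0 : (0 : ℝ) < n := by exact_mod_cast h1
  have hkR : (k : ℝ) ≤ 2 * n := by exact_mod_cast hk
  have hx := hn ((k : ℝ) / (2 * n)) ⟨by positivity, by rw [div_le_one (by positivity)]; exact hkR⟩
  have hv : L n ((k : ℝ) / (2 * n)) = ℓ n k := by
    rcases Nat.lt_or_ge k (2 * n) with hlt | hge
    · rw [hL n h1 k hlt _ ⟨le_rfl, by gcongr; linarith⟩]
      field_simp
      ring
    · obtain ⟨m, rfl⟩ : ∃ m, k = m + 1 := ⟨k - 1, by omega⟩
      rw [hL n h1 m (by omega) _ ⟨by gcongr; push_cast; linarith, by push_cast; exact le_rfl⟩]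
      push_cast
      field_simp
      ring
  rw [hv, dist_comm, Real.dist_eq] at hx
  exact hx

lemma aux_floor (u : ℝ) (hu : 0 ≤ u) :
    Tendsto (fun n : ℕ => ((⌊u * (2 * n : ℝ)⌋₊ : ℕ) : ℝ) / (2 * n)) atTop (𝓝 u) := by
  have h := tendsto_nat_floor_mul_div_atTop (R := ℝ) hu
  have h2 : Tendsto (fun n : ℕ => (2 * n : ℝ)) atTop atTop :=
    Tendsto.const_mul_atTop (by norm_num) tendsto_natCast_atTop_atTop
  exact h.comp h2

lemma aux_floor_le (u : ℝ) (hu : u ∈ Set.Icc (0 : ℝ) 1) (n : ℕ) :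
    ⌊u * (2 * n : ℝ)⌋₊ ≤ 2 * n := by
  apply Nat.floor_le_of_le
  push_cast
  have : (0 : ℝ) ≤ 2 * n := by positivity
  nlinarith [hu.2]

lemma aux_floor_f (f : ℝ → ℝ) (hf : ContinuousOn f (Set.Icc 0 1)) (u : ℝ)
    (hu : u ∈ Set.Icc (0 : ℝ) 1) :
    Tendsto (fun n : ℕ => f (((⌊u * (2 * n : ℝ)⌋₊ : ℕ) : ℝ) / (2 * n))) atTop (𝓝 (f u)) := by
  refine (hf u hu).tendsto.comp (tendsto_nhdsWithin_iff.2 ⟨aux_floor u hu.1, ?_⟩)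
  refine Eventually.of_forall fun n => ⟨by positivity, ?_⟩
  have h := aux_floor_le u hu n
  have h' : ((⌊u * (2 * n : ℝ)⌋₊ : ℕ) : ℝ) ≤ 2 * n := by exact_mod_cast h
  exact div_le_one_of_le₀ h' (by positivity)

lemma aux_inv (η : ℝ) (hη : 0 < η) : ∀ᶠ n : ℕ in atTop, (1 : ℝ) / (2 * n) < η := by
  have h2 : Tendsto (fun n : ℕ => (2 * n : ℝ)) atTop atTop :=
    Tendsto.const_mul_atTop (by norm_num) tendsto_natCast_atTop_atTop
  have := (tendsto_inv_atTop_zero.comp h2).eventually (gt_mem_nhds hη)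
  filter_upwards [this] with n hn
  simpa using hn

lemma aux_small (f : ℝ → ℝ) (hf : ContinuousOn f (Set.Icc 0 1)) (hf0 : f 0 = 0)
    (ℓ : ℕ → ℕ → ℕ) (hℓ : ∀ n, 1 ≤ n → IsDyckPath n (ℓ n)) (a : ℕ → ℝ)
    (H : ∀ η > 0, ∀ᶠ n : ℕ in atTop, ∀ k : ℕ, k ≤ 2 * n →
      |a n * ℓ n k - f ((k : ℝ) / (2 * n))| < η) :
    ∀ η > 0, ∀ᶠ n in atTop, a n < η := by
  intro η hη
  have hc := Metric.continuousWithinAt_iff.1 (hf 0 (by simp)) (η / 2) (by linarith)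
  obtain ⟨δ, hδ, hc⟩ := hc
  filter_upwards [H (η / 2) (by linarith), eventually_ge_atTop 1, aux_inv δ hδ] with n hn h1 hd
  have h := hn 1 (by omega)
  have hℓ1 : ℓ n 1 = 1 := by
    obtain ⟨h0, -, hs⟩ := hℓ n h1
    have := hs 0 (by omega)
    simp only [zero_add] at this
    omega
  have hn0 : (1 : ℝ) ≤ n := by exact_mod_cast h1
  have hp : (0 : ℝ) < 1 / (2 * n) := by positivity
  have h2 := @hc (1 / (2 * n)) ⟨hp.le, by rw [div_le_one (by positivity)]; linarith⟩
    (by rw [Real.dist_eq, sub_zero, abs_of_pos hp]; exact hd)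
  rw [hf0, Real.dist_eq, sub_zero] at h2
  rw [hℓ1] at h
  push_cast at h
  rw [abs_lt] at h h2
  linarith

lemma aux_parity {n : ℕ} {p : ℕ → ℕ} (hp : IsDyckPath n p) :
    ∀ k, k ≤ 2 * n → p k % 2 = k % 2 := by
  intro k
  induction k with
  | zero => intro _; rw [hp.1]
  | succ k ih =>
    intro hk
    have := ih (by omega)
    have := hp.2.2 k (by omega)
    omega

/-- last time at level `≤ h` before `x`. -/
lemma aux_left {n : ℕ} {p : ℕ → ℕ} (hp : IsDyckPath n p) (h i0 x : ℕ) (hix : i0 ≤ x)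
    (hx : x ≤ 2 * n) (hi0 : p i0 ≤ h) (hpx : h < p x) :
    ∃ i, i0 ≤ i ∧ i < x ∧ p i = h ∧ ∀ k, i < k → k ≤ x → h < p k := by
  induction x, hix using Nat.le_induction with
  | base => omega
  | succ x hix ih =>
    have hs := hp.2.2 x (by omega)
    by_cases hc : h < p x
    · obtain ⟨i, h1, h2, h3, h4⟩ := ih (by omega) hc
      refine ⟨i, h1, by omega, h3, fun k hk hk' => ?_⟩
      rcases Nat.lt_or_ge x k with h5 | h5
      · have : k = x + 1 := by omega
        rwa [this]
      · exact h4 k hk h5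
    · refine ⟨x, hix, by omega, by omega, fun k hk hk' => ?_⟩
      have : k = x + 1 := by omega
      rwa [this]

/-- first time at level `≤ h` after `x`. -/
lemma aux_right {n : ℕ} {p : ℕ → ℕ} (hp : IsDyckPath n p) (h x j0 : ℕ) (hxj : x ≤ j0)
    (hj : j0 ≤ 2 * n) (hj0 : p j0 ≤ h) (hpx : h < p x) :
    ∃ j, x < j ∧ j ≤ j0 ∧ p j = h ∧ ∀ k, x ≤ k → k < j → h < p k := by
  induction j0, hxj using Nat.le_induction with
  | base => omega
  | succ y hxy ih =>
    by_cases hc : p y ≤ h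
    · obtain ⟨j, h1, h2, h3, h4⟩ := ih (by omega) hc
      exact ⟨j, h1, by omega, h3, h4⟩
    · by_cases hall : ∃ j, x < j ∧ j ≤ y ∧ p j = h ∧ ∀ k, x ≤ k → k < j → h < p k
      · obtain ⟨j, h1, h2, h3, h4⟩ := hall
        exact ⟨j, h1, by omega, h3, h4⟩
      · -- all values on `[x, y]` are above `h`
        have key : ∀ z, x ≤ z → z ≤ y → ∀ k, x ≤ k → k ≤ z → h < p k := by
          intro z hz
          induction z, hz using Nat.le_induction with
          | base =>
            intro _ k h1 h2
            have : k = x := by omega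
            rwa [this]
          | succ z hz ihz =>
            intro hzy k h1 h2
            have ihz := ihz (by omega)
            rcases Nat.lt_or_ge z k with h5 | h5
            · have hk : k = z + 1 := by omega
              subst hk
              by_contra hcon
              have hs := hp.2.2 z (by omega)
              have := ihz z hz le_rfl
              exact hall ⟨z + 1, by omega, hzy, by omega, fun k hk hk' => ihz k hk (by omega)⟩
            · exact ihz k h1 h5
        have hs := hp.2.2 y (by omega)
        exact ⟨y + 1, by omega, le_rfl, by omega, fun k hk hk' => key y hxy le_rfl k hk (by omega)⟩

lemma aux_discrete {n : ℕ} {p : ℕ → ℕ} (hp : IsDyckPath n p) (h i0 x y j0 : ℕ)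
    (hix : i0 ≤ x) (hxy : x ≤ y) (hyj : y ≤ j0) (hj : j0 < 2 * n)
    (hi0 : p i0 ≤ 2 * h) (hj0 : p j0 ≤ 2 * h) (hm : ∀ k, x ≤ k → k ≤ y → 2 * h < p k) :
    ∃ i j, i0 ≤ 2 * i ∧ 2 * i ≤ x ∧ y ≤ 2 * j ∧ 2 * j ≤ j0 ∧
      segment ℝ (vtx n i) (vtx n j) ⊆ lamination n (dyckEvenClasses n p) := by
  obtain ⟨i, hi1, hi2, hi3, hi4⟩ := aux_left hp (2 * h) i0 x hix (by omega) hi0 (hm x le_rfl hxy)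
  obtain ⟨j, hj1, hj2, hj3, hj4⟩ := aux_right hp (2 * h) y j0 hyj (by omega) hj0 (hm y hxy le_rfl)
  have hpi := aux_parity hp i (by omega)
  have hpj := aux_parity hp j (by omega)
  obtain ⟨i, rfl⟩ : ∃ i', i = 2 * i' := ⟨i / 2, by omega⟩
  obtain ⟨j, rfl⟩ : ∃ j', j = 2 * j' := ⟨j / 2, by omega⟩
  have hbet : ∀ k, 2 * i < k → k < 2 * j → 2 * h < p k := by
    intro k h1 h2
    by_cases hkx : k ≤ x
    · exact hi4 k h1 hkx
    · by_cases hky : k ≤ y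
      · exact hm k (by omega) hky
      · exact hj4 k (by omega) h2
  refine ⟨i, j, hi1, hi2.le, hj1.le, hj2, ?_⟩
  intro z hz
  unfold lamination blockPolygon
  simp only [Set.mem_iUnion]
  refine ⟨{i' | i' < n ∧ DyckRel n p (2 * i') (2 * i)}, ⟨i, by omega, rfl⟩, i,
    ⟨by omega, by omega, by omega, rfl, fun k h1 h2 => ?_⟩, j,
    ⟨by omega, by omega, by omega, by omega, fun k h1 h2 => ?_⟩, ⟨by omega, Or.inl ?_⟩, hz⟩
  · have : k = 2 * i := by omega
    rw [this]
  · by_cases h3 : k = 2 * i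
    · rw [h3]; omega
    · by_cases h4 : k = 2 * j
      · rw [h4]
      · have := hbet k (by omega) (by omega)
        omega
  · rintro k ⟨hk, -, -, hk3, hk4⟩ ⟨h1, h2⟩
    have := hbet (2 * k) (by omega) (by omega)
    omega

lemma aux_chord (f : ℝ → ℝ) (hf : ContinuousOn f (Set.Icc 0 1)) (hf0 : f 0 = 0)
    (ℓ : ℕ → ℕ → ℕ) (hℓ : ∀ n, 1 ≤ n → IsDyckPath n (ℓ n)) (a : ℕ → ℝ) (ha : ∀ n, 0 < a n)
    (H : ∀ η > 0, ∀ᶠ n : ℕ in atTop, ∀ k : ℕ, k ≤ 2 * n →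
      |a n * ℓ n k - f ((k : ℝ) / (2 * n))| < η)
    (u0 u1 v1 v0 c0 c1 η : ℝ) (h0 : 0 < u0) (h01 : u0 ≤ u1) (h11 : u1 < v1) (h10 : v1 ≤ v0)
    (h1 : v0 < 1) (hc : c0 < c1) (hu0 : f u0 < c0) (hv0 : f v0 < c0)
    (hm : ∀ r ∈ Set.Icc u1 v1, c1 < f r) (hη : 0 < η) :
    ∀ᶠ n : ℕ in atTop, ∃ i j : ℕ, (i : ℝ) / n ∈ Set.Ioo (u0 - η) (u1 + η) ∧
      (j : ℝ) / n ∈ Set.Ioo (v1 - η) (v0 + η) ∧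
      segment ℝ (vtx n i) (vtx n j) ⊆ lamination n (dyckEvenClasses n (ℓ n)) := by
  have hd : 0 < (c1 - c0) / 4 := by linarith
  have hu0I : u0 ∈ Set.Icc (0 : ℝ) 1 := ⟨by linarith, by linarith⟩
  have hv0I : v0 ∈ Set.Icc (0 : ℝ) 1 := ⟨by linarith, by linarith⟩
  have hd' : 0 < (v1 - u1) / 2 := by linarith
  filter_upwards [H _ hd, aux_small f hf hf0 ℓ hℓ a H _ hd, eventually_ge_atTop 1, aux_inv η hη,
    aux_inv _ hd',
    (aux_floor_f f hf u0 hu0I).eventually (gt_mem_nhds hu0),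
    (aux_floor_f f hf v0 hv0I).eventually (gt_mem_nhds hv0)] with n hn han h1n hin hin' hfu hfv
  have hN : (0 : ℝ) < 2 * n := by
    have : (1 : ℝ) ≤ n := by exact_mod_cast h1n
    linarith
  set N : ℝ := 2 * n with hNdef
  have ea := ha n
  rw [div_lt_iff₀ hN] at hin hin'
  have fu1 : ((⌊u0 * N⌋₊ : ℕ) : ℝ) ≤ u0 * N := Nat.floor_le (by positivity)
  have fu2 := Nat.lt_floor_add_one (u0 * N)
  have fv1 : ((⌊v0 * N⌋₊ : ℕ) : ℝ) ≤ v0 * N := Nat.floor_le (by have := hv0I.1; positivity)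
  have fv2 := Nat.lt_floor_add_one (v0 * N)
  have gu1 := Nat.le_ceil (u1 * N)
  have gu2 : ((⌈u1 * N⌉₊ : ℕ) : ℝ) < u1 * N + 1 :=
    Nat.ceil_lt_add_one (by have : 0 ≤ u1 := by linarith
                            positivity)
  have gv1 : ((⌊v1 * N⌋₊ : ℕ) : ℝ) ≤ v1 * N :=
    Nat.floor_le (by have : 0 ≤ v1 := by linarith
                     positivity)
  have gv2 := Nat.lt_floor_add_one (v1 * N)
  have hj0 : ⌊v0 * N⌋₊ < 2 * n := by
    have : ((⌊v0 * N⌋₊ : ℕ) : ℝ) < ((2 * n : ℕ) : ℝ) := by push_cast; nlinarith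
    exact_mod_cast this
  have hxy : ⌈u1 * N⌉₊ ≤ ⌊v1 * N⌋₊ := by
    have : ((⌈u1 * N⌉₊ : ℕ) : ℝ) < ((⌊v1 * N⌋₊ + 1 : ℕ) : ℝ) := by push_cast; nlinarith
    have : ⌈u1 * N⌉₊ < ⌊v1 * N⌋₊ + 1 := by exact_mod_cast this
    omega
  have hix : ⌊u0 * N⌋₊ ≤ ⌈u1 * N⌉₊ := by
    have : ((⌊u0 * N⌋₊ : ℕ) : ℝ) ≤ ((⌈u1 * N⌉₊ : ℕ) : ℝ) := by nlinarith
    exact_mod_cast this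
  have hyj : ⌊v1 * N⌋₊ ≤ ⌊v0 * N⌋₊ := Nat.floor_le_floor (by nlinarith)
  have eu := abs_lt.1 (hn ⌊u0 * N⌋₊ (by omega))
  have ev := abs_lt.1 (hn ⌊v0 * N⌋₊ (by omega))
  set b : ℝ := c0 + (c1 - c0) / 4 with hb
  have hbpos : 0 < b := by
    have : 0 ≤ a n * (ℓ n ⌊u0 * N⌋₊ : ℝ) := by positivity
    linarith [eu.2]
  have hh1 := Nat.le_ceil (b / (2 * a n))
  have hh2 : ((⌈b / (2 * a n)⌉₊ : ℕ) : ℝ) < b / (2 * a n) + 1 :=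
    Nat.ceil_lt_add_one (by positivity)
  set h := ⌈b / (2 * a n)⌉₊
  have hh1' : b ≤ a n * (2 * h) := by
    rw [div_le_iff₀ (by positivity)] at hh1
    linarith
  have hh2' : a n * (2 * h) < b + 2 * a n := by
    have : (h : ℝ) * (2 * a n) < (b / (2 * a n) + 1) * (2 * a n) := by gcongr
    rw [add_mul, div_mul_cancel₀ _ (by positivity)] at this
    linarith
  have cmp : ∀ k : ℕ, a n * (ℓ n k : ℝ) < b → ℓ n k ≤ 2 * h := by
    intro k hk
    have : a n * (ℓ n k : ℝ) < a n * (2 * h) := by linarith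
    have := lt_of_mul_lt_mul_left this ea.le
    exact_mod_cast this.le
  obtain ⟨i, j, hi1, hi2, hj1, hj2, hseg⟩ := aux_discrete (hℓ n h1n) h _ _ _ _ hix hxy hyj hj0
    (cmp _ (by linarith [eu.2])) (cmp _ (by linarith [ev.2])) (by
      intro k hk1 hk2
      have ek := abs_lt.1 (hn k (by omega))
      have hk1' : ((⌈u1 * N⌉₊ : ℕ) : ℝ) ≤ k := by exact_mod_cast hk1
      have hk2' : (k : ℝ) ≤ ((⌊v1 * N⌋₊ : ℕ) : ℝ) := by exact_mod_cast hk2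
      have := hm ((k : ℝ) / N) ⟨by rw [le_div_iff₀ hN]; linarith, by rw [div_le_iff₀ hN]; linarith⟩
      have h3 : a n * (2 * h) < a n * (ℓ n k : ℝ) := by linarith [ek.1]
      have := lt_of_mul_lt_mul_left h3 ea.le
      exact_mod_cast this)
  have conv : ∀ k : ℕ, (k : ℝ) / n = (2 * k : ℝ) / N := by
    intro k
    rw [hNdef, mul_div_mul_left _ _ (by norm_num)]
  have hi1' : ((⌊u0 * N⌋₊ : ℕ) : ℝ) ≤ 2 * i := by exact_mod_cast hi1
  have hi2' : (2 * i : ℝ) ≤ ((⌈u1 * N⌉₊ : ℕ) : ℝ) := by exact_mod_cast hi2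
  have hj1' : ((⌊v1 * N⌋₊ : ℕ) : ℝ) ≤ 2 * j := by exact_mod_cast hj1
  have hj2' : (2 * j : ℝ) ≤ ((⌊v0 * N⌋₊ : ℕ) : ℝ) := by exact_mod_cast hj2
  refine ⟨i, j, ?_, ?_, hseg⟩
  · rw [conv]
    constructor
    · rw [lt_div_iff₀ hN]; linarith
    · rw [div_lt_iff₀ hN]; linarith
  · rw [conv]
    constructor
    · rw [lt_div_iff₀ hN]; linarith
    · rw [div_lt_iff₀ hN]; linarith

lemma aux_seg (x y x' y' z : ℂ) (ε : ℝ) (hx : dist x x' < ε) (hy : dist y y' < ε)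
    (hz : z ∈ segment ℝ x y) : ∃ z' ∈ segment ℝ x' y', dist z z' < ε := by
  obtain ⟨s, t, hs, ht, hst, rfl⟩ := hz
  refine ⟨s • x' + t • y', ⟨s, t, hs, ht, hst, rfl⟩, ?_⟩
  have h1 : dist (s • x + t • y) (s • x' + t • y') ≤ s * dist x x' + t * dist y y' := by
    refine (dist_add_add_le _ _ _ _).trans ?_
    rw [dist_smul₀, dist_smul₀, Real.norm_of_nonneg hs, Real.norm_of_nonneg ht]
  have : s * dist x x' + t * dist y y' < ε := by
    rcases hs.eq_or_lt with h | h
    · have : t = 1 := by linarith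
      subst this; rw [← h]; linarith
    · have h2 : s * dist x x' < s * ε := by gcongr
      have h3 : t * dist y y' ≤ t * ε := by gcongr
      have : s * ε + t * ε = ε := by rw [← add_mul, hst, one_mul]
      linarith
  linarith

lemma aux_point (n : ℕ) (p : ℕ → ℕ) (i : ℕ) (hi : i < n) :
    vtx n i ∈ lamination n (dyckEvenClasses n p) := by
  unfold lamination blockPolygon
  simp only [Set.mem_iUnion]
  have hm : i ∈ {i' | i' < n ∧ DyckRel n p (2 * i') (2 * i)} := by
    refine ⟨hi, by omega, by omega, rfl, fun k h1 h2 => ?_⟩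
    have : k = 2 * i := by omega
    rw [this]
  exact ⟨_, ⟨i, hi, rfl⟩, i, hm, i, hm, ⟨le_rfl, Or.inl (by intro k _; omega)⟩,
    left_mem_segment _ _ _⟩

/-- circle points are approximated by vertices. -/
lemma aux_deg (ℓ : ℕ → ℕ → ℕ) (s : ℝ) (hs : s ∈ Set.Ico (0 : ℝ) 1) (ε : ℝ) (hε : 0 < ε) :
    ∀ᶠ n : ℕ in atTop, ∃ w ∈ lamination n (dyckEvenClasses n (ℓ n)), dist (circlePt s) w < ε := by
  have h := (tendsto_nat_floor_mul_div_atTop (R := ℝ) hs.1).comp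
    (tendsto_natCast_atTop_atTop (R := ℝ))
  have h2 := (aux_cont.tendsto s).comp h
  filter_upwards [h2.eventually (Metric.ball_mem_nhds _ hε), eventually_ge_atTop 1] with n hn h1
  have h1' : (1 : ℝ) ≤ n := by exact_mod_cast h1
  refine ⟨vtx n ⌊s * n⌋₊, aux_point n _ _ ?_, ?_⟩
  · rw [Nat.floor_lt (by have := hs.1; positivity)]
    nlinarith [hs.2]
  · rw [aux_vtx, dist_comm]
    exact hn

lemma aux_pt1 : circlePt 1 = circlePt 0 := by
  unfold circlePt
  simp [Complex.exp_two_pi_mul_I]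

lemma aux_deg' (ℓ : ℕ → ℕ → ℕ) (s : ℝ) (hs : s ∈ Set.Icc (0 : ℝ) 1) (ε : ℝ) (hε : 0 < ε) :
    ∀ᶠ n : ℕ in atTop, ∃ w ∈ lamination n (dyckEvenClasses n (ℓ n)), dist (circlePt s) w < ε := by
  rcases hs.2.eq_or_lt with h | h
  · rw [h, aux_pt1]
    exact aux_deg ℓ 0 (by simp) ε hε
  · exact aux_deg ℓ s ⟨hs.1, h⟩ ε hε

lemma aux_close (ℓ : ℕ → ℕ → ℕ) (s t : ℝ) (ε : ℝ) (hε : 0 < ε)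
    (h : ∀ η > 0, ∀ᶠ n : ℕ in atTop, ∃ i j : ℕ, |(i : ℝ) / n - s| < η ∧ |(j : ℝ) / n - t| < η ∧
      segment ℝ (vtx n i) (vtx n j) ⊆ lamination n (dyckEvenClasses n (ℓ n))) (z : ℂ)
    (hz : z ∈ segment ℝ (circlePt s) (circlePt t)) :
    ∀ᶠ n : ℕ in atTop, ∃ w ∈ lamination n (dyckEvenClasses n (ℓ n)), dist z w < ε := by
  obtain ⟨δ1, hδ1, h1⟩ := Metric.continuousAt_iff.1 (aux_cont.continuousAt (x := s)) ε hε
  obtain ⟨δ2, hδ2, h2⟩ := Metric.continuousAt_iff.1 (aux_cont.continuousAt (x := t)) ε hε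
  filter_upwards [h (min δ1 δ2) (lt_min hδ1 hδ2)] with n ⟨i, j, hi, hj, hseg⟩
  obtain ⟨w, hw, hzw⟩ := aux_seg _ _ (vtx n i) (vtx n j) z ε
    (by rw [aux_vtx, dist_comm]; exact h1 (lt_of_lt_of_le hi (min_le_left _ _)))
    (by rw [aux_vtx, dist_comm]; exact h2 (lt_of_lt_of_le hj (min_le_right _ _))) hz
  exact ⟨w, hseg hw, hzw⟩

lemma aux_lower (f : ℝ → ℝ) (hf : ContinuousOn f (Set.Icc 0 1)) (hf0 : f 0 = 0) (hf1 : f 1 = 0)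
    (hfpos : ∀ r : ℝ, 0 < r → r < 1 → 0 < f r)
    (hmin : ∀ s t : ℝ, s ∈ Set.Ioo (0 : ℝ) 1 → t ∈ Set.Ioo (0 : ℝ) 1 → s ≠ t →
      IsLocalMinOn f (Set.Icc 0 1) s → IsLocalMinOn f (Set.Icc 0 1) t → f s ≠ f t)
    (ℓ : ℕ → ℕ → ℕ) (hℓ : ∀ n, 1 ≤ n → IsDyckPath n (ℓ n)) (a : ℕ → ℝ) (ha : ∀ n, 0 < a n)
    (H : ∀ η > 0, ∀ᶠ n : ℕ in atTop, ∀ k : ℕ, k ≤ 2 * n →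
      |a n * ℓ n k - f ((k : ℝ) / (2 * n))| < η)
    (s t : ℝ) (hs : s ∈ Set.Icc (0 : ℝ) 1) (ht : t ∈ Set.Icc (0 : ℝ) 1) (hst : s ≤ t)
    (hft : f s = f t) (hr : ∀ r ∈ Set.Icc s t, f s ≤ f r) (ε : ℝ) (hε : 0 < ε) (z : ℂ)
    (hz : z ∈ segment ℝ (circlePt s) (circlePt t)) :
    ∀ᶠ n : ℕ in atTop, ∃ w ∈ lamination n (dyckEvenClasses n (ℓ n)), dist z w < ε := by
  rcases hst.eq_or_lt with rfl | hlt
  · rw [segment_same] at hz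
    rw [Set.mem_singleton_iff.1 hz]
    exact aux_deg' ℓ s hs ε hε
  rcases hs.1.eq_or_lt with rfl | hs0
  · have ht1 : t = 1 := by
      by_contra hne
      have := hfpos t hlt (lt_of_le_of_ne ht.2 hne)
      linarith
    rw [ht1, aux_pt1, segment_same] at hz
    rw [Set.mem_singleton_iff.1 hz]
    exact aux_deg' ℓ 0 (by simp) ε hε
  have ht1 : t < 1 := by
    refine lt_of_le_of_ne ht.2 fun hne => ?_
    rw [hne, hf1] at hft
    have := hfpos s hs0 (by linarith)
    linarith
  refine aux_close ℓ s t ε hε (fun η hη => ?_) z hz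
  by_cases hin : ∀ r ∈ Set.Ioo s t, f s < f r
  · -- inner approximation
    obtain ⟨δ, hδ, hδη, hδst⟩ : ∃ δ > 0, δ < η / 2 ∧ δ < (t - s) / 2 := by
      obtain ⟨δ, h1, h2⟩ := exists_between (show 0 < min (η / 2) ((t - s) / 2) from
        lt_min (by linarith) (by linarith))
      exact ⟨δ, h1, lt_of_lt_of_le h2 (min_le_left _ _), lt_of_lt_of_le h2 (min_le_right _ _)⟩
    obtain ⟨x, hx, hxm⟩ := isCompact_Icc.exists_isMinOn (s := Set.Icc (s + δ) (t - δ)) (f := f)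
      (Set.nonempty_Icc.2 (by linarith))
      (hf.mono (Set.Icc_subset_Icc (by linarith) (by linarith)))
    have hfx := hin x ⟨by linarith [hx.1], by linarith [hx.2]⟩
    obtain ⟨c0, h1, h2⟩ := exists_between hfx
    obtain ⟨c1, h3, h4⟩ := exists_between h2
    filter_upwards [aux_chord f hf hf0 ℓ hℓ a ha H s (s + δ) (t - δ) t c0 c1 (η / 2) hs0
      (by linarith) (by linarith) (by linarith) ht1 h3 h1 (by linarith)
      (fun r hr => lt_of_lt_of_le h4 (hxm hr)) (by linarith)] with n ⟨i, j, hi, hj, hseg⟩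
    refine ⟨i, j, ?_, ?_, hseg⟩
    · rw [abs_lt]; constructor <;> linarith [hi.1, hi.2]
    · rw [abs_lt]; constructor <;> linarith [hj.1, hj.2]
  · -- outer approximation
    push Not at hin
    obtain ⟨r, hrI, hfr⟩ := hin
    have hfr' : f r = f s := le_antisymm hfr (hr r ⟨hrI.1.le, hrI.2.le⟩)
    have hrm : IsLocalMinOn f (Set.Icc 0 1) r := by
      refine Filter.Eventually.filter_mono nhdsWithin_le_nhds ?_
      filter_upwards [Ioo_mem_nhds hrI.1 hrI.2] with y hy
      rw [hfr']
      exact hr y ⟨hy.1.le, hy.2.le⟩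
    have hr01 : r ∈ Set.Ioo (0 : ℝ) 1 := ⟨by linarith [hrI.1], by linarith [hrI.2]⟩
    have hsn : ¬ IsLocalMinOn f (Set.Icc 0 1) s := fun h =>
      hmin s r ⟨hs0, by linarith⟩ hr01 hrI.1.ne h hrm hfr'.symm
    have htn : ¬ IsLocalMinOn f (Set.Icc 0 1) t := fun h =>
      hmin t r ⟨by linarith, ht1⟩ hr01 hrI.2.ne' h hrm (by rw [hfr', hft])
    have near : ∀ q ∈ Set.Icc s t, ¬ IsLocalMinOn f (Set.Icc 0 1) q → f q = f s →
        ∀ δ > 0, ∃ u, |u - q| < δ ∧ 0 < u ∧ u < 1 ∧ f u < f s := by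
      intro q hq hqn hfq δ hδ
      by_contra hcon
      push Not at hcon
      apply hqn
      refine Filter.Eventually.filter_mono nhdsWithin_le_nhds ?_
      filter_upwards [Metric.ball_mem_nhds q hδ,
        Ioo_mem_nhds (show 0 < q by linarith [hq.1]) (show q < 1 by linarith [hq.2])] with y hy hy2
      rw [hfq]
      exact hcon y hy hy2.1 hy2.2
    have hd : 0 < min (η / 2) (t - s) := lt_min (by linarith) (by linarith)
    obtain ⟨u0, hu1, hu2, hu3, hu4⟩ := near s ⟨le_rfl, hst⟩ hsn rfl _ hd
    obtain ⟨v0, hv1, hv2, hv3, hv4⟩ := near t ⟨hst, le_rfl⟩ htn hft.symm _ hd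
    have hu1a := abs_lt.1 (lt_of_lt_of_le hu1 (min_le_left _ _))
    have hu1b := abs_lt.1 (lt_of_lt_of_le hu1 (min_le_right _ _))
    have hv1a := abs_lt.1 (lt_of_lt_of_le hv1 (min_le_left _ _))
    have hv1b := abs_lt.1 (lt_of_lt_of_le hv1 (min_le_right _ _))
    have hus : u0 < s := by
      by_contra hcon
      have := hr u0 ⟨by linarith, by linarith⟩
      linarith
    have hvt : t < v0 := by
      by_contra hcon
      have := hr v0 ⟨by linarith, by linarith⟩
      linarith
    obtain ⟨c0, h1, h2⟩ := exists_between (max_lt hu4 hv4)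
    obtain ⟨c1, h3, h4⟩ := exists_between h2
    filter_upwards [aux_chord f hf hf0 ℓ hℓ a ha H u0 s t v0 c0 c1 (η / 2) hu2
      hus.le hlt hvt.le hv3 h3 (lt_of_le_of_lt (le_max_left _ _) h1)
      (lt_of_le_of_lt (le_max_right _ _) h1)
      (fun r hr' => lt_of_lt_of_le h4 (hr r hr')) (by linarith)] with n ⟨i, j, hi, hj, hseg⟩
    refine ⟨i, j, ?_, ?_, hseg⟩
    · rw [abs_lt]; constructor <;> linarith [hi.1, hi.2]
    · rw [abs_lt]; constructor <;> linarith [hj.1, hj.2]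

/-- limits of discrete chords are chords of `brownLam f`. -/
lemma aux_limit (f : ℝ → ℝ) (hf : ContinuousOn f (Set.Icc 0 1))
    (ℓ : ℕ → ℕ → ℕ) (a : ℕ → ℝ) (ha : ∀ n, 0 < a n)
    (H : ∀ η > 0, ∀ᶠ n : ℕ in atTop, ∀ k : ℕ, k ≤ 2 * n →
      |a n * ℓ n k - f ((k : ℝ) / (2 * n))| < η)
    (φ : ℕ → ℕ) (hφ : Tendsto φ atTop atTop) (i j : ℕ → ℕ)
    (hij : ∀ m, i m ≤ j m ∧ j m ≤ 2 * φ m ∧ ℓ (φ m) (i m) = ℓ (φ m) (j m) ∧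
      ∀ k, i m ≤ k → k ≤ j m → ℓ (φ m) (i m) ≤ ℓ (φ m) k)
    (s t : ℝ) (hs : Tendsto (fun m => (i m : ℝ) / (2 * φ m)) atTop (𝓝 s))
    (ht : Tendsto (fun m => (j m : ℝ) / (2 * φ m)) atTop (𝓝 t)) :
    s ∈ Set.Icc (0 : ℝ) 1 ∧ t ∈ Set.Icc (0 : ℝ) 1 ∧ simRel f s t := by
  have mem : ∀ m (k : ℕ), k ≤ 2 * φ m → (k : ℝ) / (2 * φ m) ∈ Set.Icc (0 : ℝ) 1 := by
    intro m k hk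
    have h' : (k : ℝ) ≤ 2 * φ m := by exact_mod_cast hk
    exact ⟨by positivity, div_le_one_of_le₀ h' (by positivity)⟩
  have lim : ∀ (k : ℕ → ℕ) (x : ℝ), (∀ m, k m ≤ 2 * φ m) →
      Tendsto (fun m => (k m : ℝ) / (2 * φ m)) atTop (𝓝 x) →
      x ∈ Set.Icc (0 : ℝ) 1 ∧ Tendsto (fun m => a (φ m) * ℓ (φ m) (k m)) atTop (𝓝 (f x)) := by
    intro k x hk hx
    have hxI : x ∈ Set.Icc (0 : ℝ) 1 :=
      isClosed_Icc.mem_of_tendsto hx (Eventually.of_forall fun m => mem m _ (hk m))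
    refine ⟨hxI, ?_⟩
    have h1 : Tendsto (fun m => f ((k m : ℝ) / (2 * φ m))) atTop (𝓝 (f x)) :=
      (hf x hxI).tendsto.comp (tendsto_nhdsWithin_iff.2
        ⟨hx, Eventually.of_forall fun m => mem m _ (hk m)⟩)
    have h2 : Tendsto (fun m => a (φ m) * ℓ (φ m) (k m) - f ((k m : ℝ) / (2 * φ m)))
        atTop (𝓝 0) := by
      rw [Metric.tendsto_nhds]
      intro η hη
      filter_upwards [hφ.eventually (H η hη)] with m hm
      rw [Real.dist_eq, sub_zero]
      exact hm _ (hk m)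
    have h3 := h2.add h1
    simpa using h3
  obtain ⟨hsI, hsl⟩ := lim i s (fun m => (hij m).1.trans (hij m).2.1) hs
  obtain ⟨htI, htl⟩ := lim j t (fun m => (hij m).2.1) ht
  have hst : s ≤ t := le_of_tendsto_of_tendsto' hs ht fun m => by
    have : (i m : ℝ) ≤ j m := by exact_mod_cast (hij m).1
    gcongr
  have heq : f s = f t := by
    refine tendsto_nhds_unique hsl (htl.congr fun m => ?_)
    rw [(hij m).2.2.1]
  refine ⟨hsI, htI, heq, ?_⟩
  rw [min_eq_left hst, max_eq_right hst]
  intro r h1 h2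
  rcases h1.eq_or_lt with rfl | h1
  · exact le_rfl
  rcases h2.eq_or_lt with rfl | h2
  · exact heq.le
  have hrI : r ∈ Set.Icc (0 : ℝ) 1 := ⟨by linarith [hsI.1], by linarith [htI.2]⟩
  have hfl := (aux_floor r hrI.1).comp hφ
  obtain ⟨-, hrl⟩ := lim (fun m => ⌊r * (2 * φ m : ℝ)⌋₊) r
    (fun m => aux_floor_le r hrI (φ m)) hfl
  refine le_of_tendsto_of_tendsto hsl hrl ?_
  filter_upwards [hs.eventually_lt hfl h1, hfl.eventually_lt ht h2,
    hφ.eventually (eventually_ge_atTop 1)] with m hm1 hm2 hm3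
  have hN : (0 : ℝ) < 2 * φ m := by
    have : (1 : ℝ) ≤ φ m := by exact_mod_cast hm3
    linarith
  simp only [Function.comp] at hm1 hm2
  rw [div_lt_div_iff_of_pos_right hN] at hm1 hm2
  have hle := (hij m).2.2.2 ⌊r * (2 * φ m : ℝ)⌋₊ (by exact_mod_cast hm1.le)
    (by exact_mod_cast hm2.le)
  have : (ℓ (φ m) (i m) : ℝ) ≤ ℓ (φ m) ⌊r * (2 * φ m : ℝ)⌋₊ := by exact_mod_cast hle
  exact mul_le_mul_of_nonneg_left this (ha _).le

lemma aux_lam_mem (n : ℕ) (p : ℕ → ℕ) (z : ℂ)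
    (hz : z ∈ lamination n (dyckEvenClasses n p)) :
    ∃ i j : ℕ, (i ≤ j ∧ j ≤ 2 * n ∧ p i = p j ∧ ∀ k, i ≤ k → k ≤ j → p i ≤ p k) ∧
      z ∈ segment ℝ (circlePt ((i : ℝ) / (2 * n))) (circlePt ((j : ℝ) / (2 * n))) := by
  unfold lamination blockPolygon at hz
  simp only [Set.mem_iUnion] at hz
  obtain ⟨B, ⟨c, hc, rfl⟩, i, hi, j, hj, ⟨hij, -⟩, hz⟩ := hz
  obtain ⟨hi1, hi2, hi3, hi4, hi5⟩ := hi
  obtain ⟨hj1, hj2, hj3, hj4, hj5⟩ := hj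
  refine ⟨2 * i, 2 * j, ⟨by omega, by omega, by omega, fun k h1 h2 => ?_⟩, ?_⟩
  · by_cases hk : k ≤ 2 * c
    · exact hi5 k (by omega) (by omega)
    · have := hj5 k (by omega) (by omega)
      omega
  · rw [aux_vtx, aux_vtx] at hz
    push_cast
    rw [mul_div_mul_left _ _ (by norm_num), mul_div_mul_left _ _ (by norm_num)]
    exact hz

lemma aux_upper (f : ℝ → ℝ) (hf : ContinuousOn f (Set.Icc 0 1))
    (ℓ : ℕ → ℕ → ℕ) (a : ℕ → ℝ) (ha : ∀ n, 0 < a n)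
    (H : ∀ η > 0, ∀ᶠ n : ℕ in atTop, ∀ k : ℕ, k ≤ 2 * n →
      |a n * ℓ n k - f ((k : ℝ) / (2 * n))| < η) (ε : ℝ) (hε : 0 < ε) :
    ∀ᶠ n : ℕ in atTop, ∀ z ∈ lamination n (dyckEvenClasses n (ℓ n)),
      ∃ w ∈ brownLam f, dist z w < ε := by
  by_contra hcon
  obtain ⟨φ, hφ, hbad⟩ := extraction_of_frequently_atTop (not_eventually.1 hcon)
  push Not at hbad
  choose z hz hzw using hbad
  choose i j hij hseg using fun m => aux_lam_mem _ _ _ (hz m)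
  have mem : ∀ m (k : ℕ), k ≤ 2 * φ m → (k : ℝ) / (2 * φ m) ∈ Set.Icc (0 : ℝ) 1 := by
    intro m k hk
    have h' : (k : ℝ) ≤ 2 * φ m := by exact_mod_cast hk
    exact ⟨by positivity, div_le_one_of_le₀ h' (by positivity)⟩
  obtain ⟨⟨s, t⟩, -, ψ, hψ, hlim⟩ := (isCompact_Icc.prod isCompact_Icc).tendsto_subseq
    (s := Set.Icc (0 : ℝ) 1 ×ˢ Set.Icc (0 : ℝ) 1)
    (x := fun m => ((i m : ℝ) / (2 * φ m), (j m : ℝ) / (2 * φ m)))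
    (fun m => ⟨mem m _ ((hij m).1.trans (hij m).2.1), mem m _ (hij m).2.1⟩)
  have hs := (continuous_fst.tendsto _).comp hlim
  have ht := (continuous_snd.tendsto _).comp hlim
  obtain ⟨hsI, htI, hsim⟩ := aux_limit f hf ℓ a ha H (φ ∘ ψ)
    (hφ.tendsto_atTop.comp hψ.tendsto_atTop) (i ∘ ψ) (j ∘ ψ) (fun m => hij (ψ m)) s t hs ht
  have es := ((aux_cont.tendsto s).comp hs).eventually (Metric.ball_mem_nhds _ hε)
  have et := ((aux_cont.tendsto t).comp ht).eventually (Metric.ball_mem_nhds _ hε)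
  obtain ⟨m, hm1, hm2⟩ := (es.and et).exists
  obtain ⟨w, hw, hd⟩ := aux_seg _ _ (circlePt s) (circlePt t) _ ε hm1 hm2 (hseg (ψ m))
  refine absurd hd (not_lt.2 (hzw (ψ m) w ?_))
  unfold brownLam
  simp only [Set.mem_iUnion]
  exact ⟨s, hsI, t, htI, hsim, hw⟩

end

/-- With `f` as in Statement 17, suppose moreover that
`L(f) = ⋃_{s ∼_f t} [e^{2πis}, e^{2πit}]` is closed and is a lamination of the closed unit
disk that is maximal for inclusion among laminations. Let `Q_n`, `ℓ^n`, `L_n`, `a_n` be as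
in Statement 17, with `a_n · L_n → f` uniformly on `[0,1]`. Then the Hausdorff distance
between `Λ_n(Q_n)` and `L(f)` tends to `0`. -/
theorem laminations_tendsto_brownLam (f : ℝ → ℝ) (hf : ContinuousOn f (Set.Icc 0 1))
    (hf0 : f 0 = 0) (hf1 : f 1 = 0) (hfpos : ∀ r : ℝ, 0 < r → r < 1 → 0 < f r)
    (hmin : ∀ s t : ℝ, s ∈ Set.Ioo (0 : ℝ) 1 → t ∈ Set.Ioo (0 : ℝ) 1 → s ≠ t →
      IsLocalMinOn f (Set.Icc 0 1) s → IsLocalMinOn f (Set.Icc 0 1) t → f s ≠ f t)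
    (hclosed : IsClosed (brownLam f)) (hlam : IsLamination (brownLam f))
    (hmax : ∀ A : Set ℂ, IsLamination A → brownLam f ⊆ A → A = brownLam f)
    (Q : ℕ → Set (Set ℕ)) (hQ : ∀ n, 1 ≤ n → IsNCPartition n (Q n))
    (ℓ : ℕ → ℕ → ℕ)
    (hℓ : ∀ n, 1 ≤ n → IsDyckPath n (ℓ n) ∧ dyckEvenClasses n (ℓ n) = Q n)
    (L : ℕ → ℝ → ℝ)
    (hL : ∀ n : ℕ, 1 ≤ n → ∀ k : ℕ, k < 2 * n → ∀ x : ℝ,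
      x ∈ Set.Icc ((k : ℝ) / (2 * n)) (((k : ℝ) + 1) / (2 * n)) →
      L n x = (ℓ n k : ℝ) + ((2 * n : ℝ) * x - (k : ℝ)) * ((ℓ n (k + 1) : ℝ) - (ℓ n k : ℝ)))
    (a : ℕ → ℝ) (ha : ∀ n, 0 < a n)
    (hconv : TendstoUniformlyOn (fun n x => a n * L n x) f Filter.atTop (Set.Icc 0 1)) :
    Filter.Tendsto (fun n => Metric.hausdorffDist (lamination n (Q n)) (brownLam f))
      Filter.atTop (nhds 0) := by
  have H := aux_evt f ℓ L hL a hconv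
  have hD : ∀ n, 1 ≤ n → IsDyckPath n (ℓ n) := fun n hn => (hℓ n hn).1
  have hcomp : IsCompact (brownLam f) :=
    (isCompact_closedBall (0 : ℂ) 1).of_isClosed_subset hclosed hlam.2.1
  have lower : ∀ ε > 0, ∀ z ∈ brownLam f,
      ∀ᶠ n : ℕ in Filter.atTop, ∃ w ∈ lamination n (dyckEvenClasses n (ℓ n)), dist z w < ε := by
    intro ε hε z hz
    unfold brownLam at hz
    simp only [Set.mem_iUnion] at hz
    obtain ⟨s, hs, t, ht, ⟨h1, h2⟩, hz⟩ := hz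
    rcases le_total s t with hst | hst
    · rw [min_eq_left hst, max_eq_right hst] at h2
      exact aux_lower f hf hf0 hf1 hfpos hmin ℓ hD a ha H s t hs ht hst h1
        (fun r hr => h2 r hr.1 hr.2) ε hε z hz
    · rw [min_eq_right hst, max_eq_left hst] at h2
      rw [segment_symm] at hz
      exact aux_lower f hf hf0 hf1 hfpos hmin ℓ hD a ha H t s ht hs hst h1.symm
        (fun r hr => h1 ▸ h2 r hr.1 hr.2) ε hε z hz
  rw [Metric.tendsto_nhds]
  intro ε hε
  obtain ⟨T, hTs, hTf, hTc⟩ := hcomp.finite_cover_balls (show 0 < ε / 4 by linarith)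
  have hlow := (Filter.eventually_all_finite hTf).2
    (fun z hz => lower (ε / 4) (by linarith) z (hTs hz))
  filter_upwards [hlow, aux_upper f hf ℓ a ha H (ε / 2) (by linarith),
    Filter.eventually_ge_atTop 1] with n hl hu h1
  rw [(hℓ n h1).2] at hl hu
  rw [Real.dist_eq, sub_zero, abs_of_nonneg Metric.hausdorffDist_nonneg]
  refine lt_of_le_of_lt (Metric.hausdorffDist_le_of_mem_dist (r := ε / 2) (by linarith) ?_ ?_)
    (by linarith)
  · intro z hz
    obtain ⟨w, hw, hd⟩ := hu z hz
    exact ⟨w, hw, hd.le⟩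
  · intro z hz
    have hzc := hTc hz
    simp only [Set.mem_iUnion] at hzc
    obtain ⟨y, hy, hzy⟩ := hzc
    obtain ⟨w, hw, hd⟩ := hl y hy
    refine ⟨w, hw, ?_⟩
    have := dist_triangle z y w
    rw [Metric.mem_ball] at hzy
    linarith
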